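/- There exists a co-Büchi coverage game (G, 2, β) with exactly three objectives (|β| = 3) that is undetermined: Coverer has no covering strategy in (G, 2, β), and Disruptor has no disrupting strategy in (G, 2, β). -/

import Mathlib

open scoped Classical

universe u

/-- A strategy: maps the strict history (the play so far, excluding the current
vertex) and the current vertex to a next vertex. -/
abbrev Strat (V : Type u) := List V → V → V

/-- A two-player game graph `G = (V₁, V₂, v₀, E)`. -/
structure GameGraph (V : Type u) where
  V1 : Set V
  V2 : Set V
  init : V
  E : V → V → Prop

namespace GameGraph

variable {V : Type u}

/-- `V₁` and `V₂` are disjoint, together cover all vertices, and `E` is total. -/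
def WellFormed (G : GameGraph V) : Prop :=
  Disjoint G.V1 G.V2 ∧ G.V1 ∪ G.V2 = Set.univ ∧ ∀ v, ∃ u, G.E v u

/-- `f` is a Player-1 strategy: at every history ending in a Player-1 vertex,
it chooses an `E`-successor. -/
def IsStrategy1 (G : GameGraph V) (f : Strat V) : Prop :=
  ∀ (h : List V) (v : V), v ∈ G.V1 → G.E v (f h v)

/-- `f` is a Player-2 strategy. -/
def IsStrategy2 (G : GameGraph V) (f : Strat V) : Prop :=
  ∀ (h : List V) (v : V), v ∈ G.V2 → G.E v (f h v)

/-- The pair (strict history, current vertex) after `n` steps from `v`, when the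
players move according to `f1` and `f2`. -/
noncomputable def run (G : GameGraph V) (f1 f2 : Strat V) (v : V) : ℕ → List V × V
  | 0 => ([], v)
  | n + 1 =>
      let p := run G f1 f2 v n
      (p.1 ++ [p.2], if p.2 ∈ G.V1 then f1 p.1 p.2 else f2 p.1 p.2)

/-- The play from `v` generated by `f1` and `f2`. -/
noncomputable def outcomeFrom (G : GameGraph V) (f1 f2 : Strat V) (v : V) (n : ℕ) : V :=
  (G.run f1 f2 v n).2

/-- The play from the initial vertex generated by `f1` and `f2`. -/
noncomputable def outcome (G : GameGraph V) (f1 f2 : Strat V) : ℕ → V :=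
  G.outcomeFrom f1 f2 G.init

/-- `Gᵛ`: the same game graph with initial vertex `v`. -/
def withInit (G : GameGraph V) (v : V) : GameGraph V := { G with init := v }

end GameGraph

variable {V : Type u}

/-- The set of vertices visited infinitely often along a play. -/
def infSet (ρ : ℕ → V) : Set V := { u | ∀ n, ∃ m, n ≤ m ∧ ρ m = u }

/-- The two objective types: Büchi and co-Büchi. -/
inductive ObjKind : Type
  | buchi
  | cobuchi

/-- Satisfaction of a `γ` objective `α` by a play `ρ`. -/
def SatObj (γ : ObjKind) (ρ : ℕ → V) (α : Set V) : Prop :=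
  match γ with
  | .buchi => (infSet ρ ∩ α).Nonempty
  | .cobuchi => infSet ρ ∩ α = ∅

/-- `F` is a covering strategy in the `γ`-coverage game `(G, k, β)`: against every
Player-2 strategy, every objective of `β` is satisfied by the play of some agent. -/
def IsCovering (G : GameGraph V) (γ : ObjKind) (k : ℕ) (β : Finset (Set V))
    (F : Fin k → Strat V) : Prop :=
  ∀ f2, G.IsStrategy2 f2 → ∀ α ∈ β, ∃ i, SatObj γ (G.outcome (F i) f2) α

/-- Coverer has a covering strategy in the `γ`-coverage game `(G, k, β)`. -/
def CovererWins (G : GameGraph V) (γ : ObjKind) (k : ℕ) (β : Finset (Set V)) : Prop :=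
  ∃ F : Fin k → Strat V, (∀ i, G.IsStrategy1 (F i)) ∧ IsCovering G γ k β F

/-- `f2` is a disrupting strategy in the `γ`-coverage game `(G, k, β)`: against every
Coverer strategy, some objective of `β` is satisfied by none of the agents' plays. -/
def IsDisrupting (G : GameGraph V) (γ : ObjKind) (k : ℕ) (β : Finset (Set V))
    (f2 : Strat V) : Prop :=
  ∀ F : Fin k → Strat V, (∀ i, G.IsStrategy1 (F i)) →
    ∃ α ∈ β, ∀ i, ¬ SatObj γ (G.outcome (F i) f2) α

/-- Disruptor has a disrupting strategy in the `γ`-coverage game `(G, k, β)`. -/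
def DisruptorWins (G : GameGraph V) (γ : ObjKind) (k : ℕ) (β : Finset (Set V)) : Prop :=
  ∃ f2, G.IsStrategy2 f2 ∧ IsDisrupting G γ k β f2

abbrev UV := Option (Fin 3 ⊕ Fin 3)

/-- The root moves to a branch `i`, a branch `i` moves to a sink `j ≠ i`. -/
def UE : UV → UV → Prop
  | none, some (Sum.inl _) => True
  | some (Sum.inl i), some (Sum.inr j) => j ≠ i
  | some (Sum.inr i), some (Sum.inr j) => j = i
  | _, _ => False

def UG : GameGraph UV where
  V1 := {none}
  V2 := {none}ᶜ
  init := none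
  E := UE

theorem UE_none {v : UV} (h : UE none v) : ∃ i, v = some (Sum.inl i) := by
  rcases v with _ | i | i
  · exact h.elim
  · exact ⟨i, rfl⟩
  · exact h.elim

theorem UE_inl {i : Fin 3} {v : UV} (h : UE (some (Sum.inl i)) v) :
    ∃ j, j ≠ i ∧ v = some (Sum.inr j) := by
  rcases v with _ | j | j
  · exact h.elim
  · exact h.elim
  · exact ⟨j, h, rfl⟩

theorem UE_inr {i : Fin 3} {v : UV} (h : UE (some (Sum.inr i)) v) :
    v = some (Sum.inr i) := by
  rcases v with _ | j | j
  · exact h.elim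
  · exact h.elim
  · have h' : j = i := h
    rw [h']

theorem U_outcome (f1 f2 : Strat UV) (h2 : UG.IsStrategy2 f2) (i j : Fin 3)
    (hi : f1 [] none = some (Sum.inl i))
    (hj : f2 [none] (some (Sum.inl i)) = some (Sum.inr j)) (n : ℕ) :
    UG.outcome f1 f2 (n + 2) = some (Sum.inr j) := by
  have r0 : UG.run f1 f2 none 0 = ([], none) := rfl
  have r1 : UG.run f1 f2 none 1 = ([none], some (Sum.inl i)) := by
    rw [GameGraph.run, r0]
    simp [UG, hi]
  show (UG.run f1 f2 none (n + 2)).2 = some (Sum.inr j)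
  induction n with
  | zero =>
    rw [GameGraph.run, r1]
    simp [UG, hj]
  | succ n ih =>
    rw [GameGraph.run]
    simp only [ih]
    rw [if_neg (by simp [UG])]
    exact UE_inr (h2 _ _ (by simp [UG]))

theorem U_sat (f1 f2 : Strat UV) (h2 : UG.IsStrategy2 f2) (i j : Fin 3)
    (hi : f1 [] none = some (Sum.inl i))
    (hj : f2 [none] (some (Sum.inl i)) = some (Sum.inr j)) (k : Fin 3) :
    SatObj ObjKind.cobuchi (UG.outcome f1 f2) {some (Sum.inr k)} ↔ k ≠ j := by
  have ho := U_outcome f1 f2 h2 i j hi hj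
  have hs : infSet (UG.outcome f1 f2) = {some (Sum.inr j)} := by
    ext u
    constructor
    · intro h
      obtain ⟨m, hm, e⟩ := h 2
      obtain ⟨n, rfl⟩ := Nat.exists_eq_add_of_le' hm
      rw [ho] at e
      exact e.symm
    · rintro rfl n
      exact ⟨n + 2, by omega, ho n⟩
  simp only [SatObj, hs]
  rw [Set.singleton_inter_eq_empty]
  simp [eq_comm]

def Uβ : Finset (Set UV) :=
  (Finset.univ : Finset (Fin 3)).map
    ⟨fun k => {some (Sum.inr k)}, fun a b h => by simpa using h⟩

theorem mem_Uβ (α : Set UV) : α ∈ Uβ ↔ ∃ k : Fin 3, {some (Sum.inr k)} = α := by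
  simp only [Uβ, Finset.mem_map, Finset.mem_univ, true_and]
  rfl

theorem U_cov : ¬ CovererWins UG ObjKind.cobuchi 2 Uβ := by
  rintro ⟨F, hF, hc⟩
  obtain ⟨a, ha⟩ := UE_none (hF 0 [] none rfl)
  obtain ⟨b, hb⟩ := UE_none (hF 1 [] none rfl)
  obtain ⟨k, hka, hkb⟩ : ∃ k : Fin 3, k ≠ a ∧ k ≠ b := by
    clear ha hb
    revert a b; decide
  let f2 : Strat UV := fun _ v => match v with
    | none => none
    | some (Sum.inl i) => if k ≠ i then some (Sum.inr k) else some (Sum.inr (i + 1))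
    | some (Sum.inr i) => some (Sum.inr i)
  have h2 : UG.IsStrategy2 f2 := by
    rintro h (_ | i | i) hv
    · exact (hv rfl).elim
    · show UE _ (if k ≠ i then some (Sum.inr k) else some (Sum.inr (i + 1)))
      split_ifs with hk
      · exact hk
      · show i + 1 ≠ i
        clear hv hk
        revert i; decide
    · exact (rfl : i = i)
  obtain ⟨i, hi⟩ := hc f2 h2 {some (Sum.inr k)} ((mem_Uβ _).2 ⟨k, rfl⟩)
  have key : ∃ c, k ≠ c ∧ F i [] none = some (Sum.inl c) := by
    fin_cases i
    · exact ⟨a, hka, ha⟩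
    · exact ⟨b, hkb, hb⟩
  obtain ⟨c, hkc, hFc⟩ := key
  exact (U_sat (F i) f2 h2 c k hFc (if_pos hkc) k).1 hi rfl

theorem U_dis : ¬ DisruptorWins UG ObjKind.cobuchi 2 Uβ := by
  rintro ⟨f2, h2, hd⟩
  have hg : ∀ i : Fin 3, ∃ j, j ≠ i ∧ f2 [none] (some (Sum.inl i)) = some (Sum.inr j) :=
    fun i => UE_inl (h2 [none] (some (Sum.inl i)) (by simp [UG]))
  choose g hne hg using hg
  obtain ⟨b, hb⟩ : ∃ b, g b ≠ g 0 := ⟨g 0, hne _⟩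
  let c : Fin 2 → Fin 3 := ![0, b]
  let F : Fin 2 → Strat UV := fun i _ _ => some (Sum.inl (c i))
  have hF : ∀ i, UG.IsStrategy1 (F i) := by
    intro i h v hv
    obtain rfl : v = none := hv
    exact trivial
  obtain ⟨α, hα, hn⟩ := hd F hF
  obtain ⟨k, rfl⟩ := (mem_Uβ α).1 hα
  have e : ∀ i, k = g (c i) := by
    intro i
    by_contra hk
    exact hn i ((U_sat (F i) f2 h2 (c i) _ rfl (hg _) k).2 hk)
  exact hb ((e 1).symm.trans (e 0))

/-- there is an undetermined co-Büchi coverage game with two agents and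
exactly three objectives. -/
theorem stmt4 :
    ∃ (V : Type) (G : GameGraph V) (β : Finset (Set V)),
      Finite V ∧ G.WellFormed ∧ β.card = 3 ∧
      ¬ CovererWins G ObjKind.cobuchi 2 β ∧ ¬ DisruptorWins G ObjKind.cobuchi 2 β := by
  refine ⟨UV, UG, Uβ, inferInstance, ⟨?_, ?_, ?_⟩, by simp [Uβ], U_cov, U_dis⟩
  · exact disjoint_compl_right
  · exact Set.union_compl_self _
  · rintro (_ | i | i)
    · exact ⟨some (Sum.inl 0), trivial⟩
    · refine ⟨some (Sum.inr (i + 1)), ?_⟩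
      show i + 1 ≠ i
      revert i; decide
    · exact ⟨some (Sum.inr i), (rfl : i = i)⟩
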